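/- There exists a constant C_E > 1 such that for every pair of points x, y in ℝ² there is a rectifiable curve γ joining x and y whose Euclidean length satisfies ℓ(γ) ≤ C_E |x − y| and whose image meets E in at most 2 points. -/

import Mathlib

open MeasureTheory Metric Filter Topology
open scoped NNReal ENNReal

noncomputable section

/-- The plane with the Euclidean distance. -/
abbrev E2 := EuclideanSpace ℝ (Fin 2)

/-- Length of the level-`n` intervals of the Cantor construction: at each step the open
middle interval of length `(1/10)^(n+1)` is removed and two closed intervals of equal
length remain. -/
def clen : ℕ → ℝ
  | 0 => 1
  | n + 1 => (clen n - (1 / 10) ^ (n + 1)) / 2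

/-- Left endpoint of the interval `I_w`; words are written with the innermost (deepest)
digit first, `false` = left child, `true` = right child. -/
def cleft : List Bool → ℝ
  | [] => 0
  | b :: w => cleft w + if b then clen w.length - clen (w.length + 1) else 0

/-- The interval `I_w` of the Cantor construction. -/
def cInt (w : List Bool) : Set ℝ := Set.Icc (cleft w) (cleft w + clen w.length)

/-- The fat Cantor set `F`. -/
def cantorF : Set ℝ := ⋂ n : ℕ, ⋃ w ∈ {w : List Bool | w.length = n}, cInt w

/-- The planar Cantor set `E = F × F`. -/
def cantorE : Set E2 := {z | z 0 ∈ cantorF ∧ z 1 ∈ cantorF}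

/-! ### The complement of the Cantor set is dense -/

lemma pow_le_clen (n : ℕ) : (1 / 10 : ℝ) ^ n ≤ clen n := by
  induction n with
  | zero => simp [clen]
  | succ n ih =>
    have h : (0 : ℝ) < (1 / 10) ^ n := by positivity
    simp only [clen, pow_succ] at *
    linarith

lemma clen_le_pow (n : ℕ) : clen n ≤ (1 / 2 : ℝ) ^ n := by
  induction n with
  | zero => simp [clen]
  | succ n ih =>
    have h : (0 : ℝ) < (1 / 10) ^ (n + 1) := by positivity
    rw [clen, pow_succ (1 / 2 : ℝ)]
    linarith

lemma clen_pos (n : ℕ) : 0 < clen n :=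
  lt_of_lt_of_le (by positivity) (pow_le_clen n)

lemma two_mul_clen_succ_lt (n : ℕ) : 2 * clen (n + 1) < clen n := by
  have h : (0 : ℝ) < (1 / 10) ^ (n + 1) := by positivity
  rw [clen]
  linarith

lemma cInt_cons_subset (b : Bool) (w : List Bool) : cInt (b :: w) ⊆ cInt w := by
  have h₁ := two_mul_clen_succ_lt w.length
  have h₂ := clen_pos (w.length + 1)
  rintro x ⟨hx₁, hx₂⟩
  cases b <;> simp [cleft] at hx₁ hx₂ <;> constructor <;> linarith

lemma eq_of_mem_cInt {x : ℝ} : ∀ {v w : List Bool}, v.length = w.length →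
    x ∈ cInt v → x ∈ cInt w → v = w
  | [], [], _, _, _ => rfl
  | b :: v, c :: w, hl, hv, hw => by
    obtain rfl : v = w :=
      eq_of_mem_cInt (by simpa using hl) (cInt_cons_subset b v hv) (cInt_cons_subset c w hw)
    have h := two_mul_clen_succ_lt v.length
    obtain ⟨hv₁, hv₂⟩ := hv
    obtain ⟨hw₁, hw₂⟩ := hw
    cases b <;> cases c <;> simp [cleft] at hv₁ hv₂ hw₁ hw₂ ⊢ <;> linarith

lemma exists_mem_cInt {x : ℝ} (hx : x ∈ cantorF) (n : ℕ) :
    ∃ w : List Bool, w.length = n ∧ x ∈ cInt w := by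
  simpa [cantorF] using Set.mem_iInter.1 hx n

lemma midpoint_cInt_notMem (w : List Bool) : cleft w + clen w.length / 2 ∉ cantorF := by
  intro hc
  obtain ⟨v, hv, hcv⟩ := exists_mem_cInt hc (w.length + 1)
  have hpos := clen_pos w.length
  match v, hv, hcv with
  | b :: v, hv, hcv =>
    obtain rfl : v = w := eq_of_mem_cInt (by simpa using hv) (cInt_cons_subset b v hcv)
      ⟨by linarith, by linarith⟩
    have h := two_mul_clen_succ_lt v.length
    obtain ⟨h₁, h₂⟩ := hcv
    cases b <;> simp [cleft] at h₁ h₂ <;> linarith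

lemma dense_compl_cantorF : Dense cantorFᶜ := by
  refine Metric.dense_iff.2 fun x r hr => ?_
  by_cases hx : x ∈ cantorF
  · obtain ⟨n, hn⟩ := exists_pow_lt_of_lt_one hr (by norm_num : (1 / 2 : ℝ) < 1)
    obtain ⟨w, rfl, hw⟩ := exists_mem_cInt hx n
    refine ⟨_, ?_, midpoint_cInt_notMem w⟩
    have h₁ := clen_le_pow w.length
    have h₂ := clen_pos w.length
    obtain ⟨hw₁, hw₂⟩ := hw
    rw [Metric.mem_ball, Real.dist_eq, abs_lt]
    constructor <;> linarith
  · exact ⟨x, Metric.mem_ball_self hr, hx⟩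

/-! ### Infinite staircases -/

/-- The piecewise linear function that is constant equal to `0` before `0` and to `1` after `1`. -/
def ramp (x : ℝ) : ℝ := max 0 (min 1 x)

lemma continuous_ramp : Continuous ramp := by unfold ramp; fun_prop

lemma monotone_ramp : Monotone ramp := fun _ _ h => by unfold ramp; gcongr

lemma ramp_nonneg (x : ℝ) : 0 ≤ ramp x := le_max_left _ _

lemma ramp_le_one (x : ℝ) : ramp x ≤ 1 := by simp [ramp]

lemma ramp_of_nonpos {x : ℝ} (h : x ≤ 0) : ramp x = 0 := by
  simp [ramp, h]

lemma ramp_of_one_le {x : ℝ} (h : 1 ≤ x) : ramp x = 1 := by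
  simp [ramp, h]

/-- The staircase which climbs from `t (n + 1)` to `t n` on
`[c / 2 ^ (n + 2), (c + 1) / 2 ^ (n + 2)]` and is constant in between. -/
def stair (t : ℕ → ℝ) (c u : ℝ) : ℝ :=
  ∑' n, (t n - t (n + 1)) * ramp (2 ^ n * (4 * u) - c)

section Stair

variable {t : ℕ → ℝ}

lemma hasSum_sub_succ (ht : Antitone t) (h0 : Tendsto t atTop (𝓝 0)) (n : ℕ) :
    HasSum (fun m => t (m + n) - t (m + n + 1)) (t n) := by
  rw [hasSum_iff_tendsto_nat_of_nonneg fun m => sub_nonneg.2 (ht (Nat.le_succ _))]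
  have h : ∀ N, ∑ m ∈ Finset.range N, (t (m + n) - t (m + n + 1)) = t n - t (N + n) := by
    intro N
    have := Finset.sum_range_sub' (fun m => t (m + n)) N
    simpa [add_right_comm] using this
  simp only [h]
  simpa using tendsto_const_nhds.sub ((tendsto_add_atTop_iff_nat n).2 h0)

lemma norm_stair_term_le (ht : Antitone t) (c : ℝ) (n : ℕ) (u : ℝ) :
    ‖(t n - t (n + 1)) * ramp (2 ^ n * (4 * u) - c)‖ ≤ t n - t (n + 1) := by
  have h := sub_nonneg.2 (ht (Nat.le_succ n))
  rw [Real.norm_of_nonneg (mul_nonneg h (ramp_nonneg _))]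
  exact mul_le_of_le_one_right h (ramp_le_one _)

lemma summable_stair (ht : Antitone t) (h0 : Tendsto t atTop (𝓝 0)) (c u : ℝ) :
    Summable fun n => (t n - t (n + 1)) * ramp (2 ^ n * (4 * u) - c) :=
  (hasSum_sub_succ ht h0 0).summable.of_norm_bounded fun n => norm_stair_term_le ht c n u

lemma continuous_stair (ht : Antitone t) (h0 : Tendsto t atTop (𝓝 0)) (c : ℝ) :
    Continuous (stair t c) := by
  refine continuous_tsum (fun n => ?_) (hasSum_sub_succ ht h0 0).summable
    fun n u => norm_stair_term_le ht c n u
  exact continuous_const.mul (continuous_ramp.comp (by fun_prop))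

lemma monotone_stair (ht : Antitone t) (h0 : Tendsto t atTop (𝓝 0)) (c : ℝ) :
    Monotone (stair t c) := by
  intro u v huv
  refine (summable_stair ht h0 c u).tsum_le_tsum (fun n => ?_) (summable_stair ht h0 c v)
  refine mul_le_mul_of_nonneg_left (monotone_ramp ?_) (sub_nonneg.2 (ht (Nat.le_succ n)))
  gcongr

lemma stair_zero {c : ℝ} (hc : 0 ≤ c) : stair t c 0 = 0 := by
  simp [stair, ramp_of_nonpos (neg_nonpos.2 hc)]

lemma stair_eq (ht : Antitone t) (h0 : Tendsto t atTop (𝓝 0)) {c u : ℝ} {n : ℕ}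
    (hlt : ∀ m < n, 2 ^ m * (4 * u) ≤ c) (hge : ∀ m ≥ n, c + 1 ≤ 2 ^ m * (4 * u)) :
    stair t c u = t n := by
  rw [stair, ← (summable_stair ht h0 c u).sum_add_tsum_nat_add n, Finset.sum_eq_zero, zero_add,
    ← (hasSum_sub_succ ht h0 n).tsum_eq]
  · refine tsum_congr fun m => ?_
    rw [ramp_of_one_le, mul_one]
    have := hge (m + n) (Nat.le_add_left n m)
    linarith
  · intro m hm
    rw [ramp_of_nonpos, mul_zero]
    have := hlt m (Finset.mem_range.1 hm)
    linarith

end Stair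

lemma exists_antitone_seq_mem {D : Set ℝ} (hD : Dense D) (h1 : 1 ∈ D) :
    ∃ t : ℕ → ℝ, Antitone t ∧ Tendsto t atTop (𝓝 0) ∧ t 0 = 1 ∧ ∀ n, t n ∈ D := by
  have h : ∀ n : ℕ, ∃ a ∈ D, (1 / 2 : ℝ) ^ (n + 1) ≤ a ∧ a ≤ (1 / 2) ^ n ∧ (n = 0 → a = 1) := by
    rintro (_ | n)
    · exact ⟨1, h1, by norm_num⟩
    · obtain ⟨a, ha, h₁, h₂⟩ := hD.exists_between
        (pow_lt_pow_right_of_lt_one₀ (by norm_num) (by norm_num) (Nat.lt_succ_self (n + 1)) :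
          (1 / 2 : ℝ) ^ (n + 1 + 1) < (1 / 2) ^ (n + 1))
      exact ⟨a, ha, h₁.le, h₂.le, by simp⟩
  choose t htD hlow hup hzero using h
  refine ⟨t, antitone_nat_of_succ_le fun n => (hup _).trans (hlow n), ?_, hzero 0 rfl, htD⟩
  exact squeeze_zero (fun n => le_trans (by positivity) (hlow n)) hup
    (tendsto_pow_atTop_nhds_zero_of_lt_one (by norm_num) (by norm_num))

/-- Two monotone functions climbing from `0` to `1` such that at every positive time one of them
lies in its prescribed dense set. -/
lemma exists_monotone_pair {D₀ D₁ : Set ℝ} (hD₀ : Dense D₀) (hD₁ : Dense D₁)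
    (h₀ : 1 ∈ D₀) (h₁ : 1 ∈ D₁) :
    ∃ A B : ℝ → ℝ, Continuous A ∧ Continuous B ∧ Monotone A ∧ Monotone B ∧ A 0 = 0 ∧ B 0 = 0 ∧
      (∀ u ≥ 1, A u = 1) ∧ (∀ u ≥ 1, B u = 1) ∧ ∀ u > 0, A u ∈ D₀ ∨ B u ∈ D₁ := by
  obtain ⟨t, ht, ht0, ht1, htD⟩ := exists_antitone_seq_mem hD₀ h₀
  obtain ⟨s, hs, hs0, hs1, hsD⟩ := exists_antitone_seq_mem hD₁ h₁
  have hone : ∀ {u : ℝ}, 1 ≤ u → ∀ m : ℕ, (4 : ℝ) ≤ 2 ^ m * (4 * u) := fun hu m => by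
    have : (1 : ℝ) ≤ 2 ^ m := one_le_pow₀ (by norm_num)
    nlinarith
  refine ⟨stair t 3, stair s 2, continuous_stair ht ht0 3, continuous_stair hs hs0 2,
    monotone_stair ht ht0 3, monotone_stair hs hs0 2, stair_zero (by norm_num),
    stair_zero (by norm_num), fun u hu => ?_, fun u hu => ?_, fun u hu => ?_⟩
  · rw [stair_eq ht ht0 (n := 0) (by simp) fun m _ => by linarith [hone hu m], ht1]
  · rw [stair_eq hs hs0 (n := 0) (by simp) fun m _ => by linarith [hone hu m], hs1]
  have hex : ∃ n : ℕ, 3 ≤ 2 ^ n * (4 * u) := by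
    obtain ⟨n, hn⟩ := pow_unbounded_of_one_lt (3 / (4 * u)) (by norm_num : (1 : ℝ) < 2)
    exact ⟨n, ((div_lt_iff₀ (by positivity)).1 hn).le⟩
  classical
  let n := Nat.find hex
  have hn : 3 ≤ 2 ^ n * (4 * u) := Nat.find_spec hex
  have hlt : ∀ m < n, 2 ^ m * (4 * u) < 3 := fun m hm => not_le.1 (Nat.find_min hex hm)
  have hmono : ∀ {k m : ℕ}, k ≤ m → (2 : ℝ) ^ k * (4 * u) ≤ 2 ^ m * (4 * u) := fun hkm => by
    gcongr
    norm_num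
  by_cases h4 : 4 ≤ 2 ^ n * (4 * u)
  · left
    rw [stair_eq ht ht0 (n := n) (fun m hm => (hlt m hm).le)
      fun m hm => by linarith [hmono (ge_iff_le.1 hm)]]
    exact htD n
  · right
    rw [stair_eq hs hs0 (n := n) (fun m hm => ?_)
      fun m hm => by linarith [hmono (ge_iff_le.1 hm)]]
    · exact hsD n
    · have h : (2 : ℝ) ^ (m + 1) * (4 * u) ≤ 2 ^ n * (4 * u) := hmono hm
      rw [pow_succ] at h
      linarith

/-! ### Curves in the plane -/

lemma dist_le_abs_add_abs (p q : E2) : dist p q ≤ |p 0 - q 0| + |p 1 - q 1| := by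
  rw [EuclideanSpace.dist_eq, Fin.sum_univ_two, Real.dist_eq, Real.dist_eq]
  refine Real.sqrt_le_iff.2 ⟨by positivity, ?_⟩
  nlinarith [abs_nonneg (p 0 - q 0), abs_nonneg (p 1 - q 1)]

lemma abs_sub_apply_le_dist (p q : E2) (i : Fin 2) : |p i - q i| ≤ dist p q := by
  rw [dist_eq_norm]
  exact PiLp.norm_apply_le (p - q) i

lemma eVariationOn_le_of_dist_le {X : Type*} [PseudoMetricSpace X] {γ : ℝ → X} {G : ℝ → ℝ}
    (h : ∀ s t, s ≤ t → dist (γ s) (γ t) ≤ G t - G s) (a b : ℝ) :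
    eVariationOn γ (Set.Icc a b) ≤ ENNReal.ofReal (G b - G a) := by
  by_cases hab : a ≤ b
  · have hG : Monotone G := fun s t hst => sub_nonneg.1 (dist_nonneg.trans (h s t hst))
    have hvar := (hG.monotoneOn (Set.Icc a b)).eVariationOn_eq
      (Set.left_mem_Icc.2 hab) (Set.right_mem_Icc.2 hab)
    rw [Set.inter_self] at hvar
    refine le_trans (iSup_mono fun p => Finset.sum_le_sum fun i _ => ?_) hvar.le
    have hp := p.2.property.1 (Nat.le_succ i)
    rw [edist_comm, edist_dist, edist_dist, Real.dist_eq]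
    exact ENNReal.ofReal_le_ofReal ((h _ _ hp).trans (le_abs_self _))
  · simp [Set.Icc_eq_empty hab]

lemma dense_preimage_affine {D : Set ℝ} (hD : Dense D) (x : ℝ) {c : ℝ} (hc : c ≠ 0) :
    Dense ((fun s => x + c * s) ⁻¹' D) :=
  hD.preimage ((Homeomorph.mulLeft₀ c hc).trans (Homeomorph.addLeft x)).isOpenMap

/-- A curve from `x` to a point `z` on no coordinate line through `cantorE`, which avoids `cantorE`
after time `0`; its length is controlled by the increments of `M`. -/
lemma exists_curve_avoiding {x z : E2} (hxz : ∀ i, x i < z i) (hz : ∀ i, z i ∉ cantorF) :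
    ∃ (P : ℝ → E2) (M : ℝ → ℝ), Continuous P ∧ P 0 = x ∧ (∀ u ≥ 1, P u = z) ∧
      (∀ u > 0, P u ∉ cantorE) ∧ (∀ s t, s ≤ t → dist (P s) (P t) ≤ M t - M s) ∧
      M 0 = 0 ∧ ∀ u ≥ 1, M u = (z 0 - x 0) + (z 1 - x 1) := by
  have hpos : ∀ i, 0 < z i - x i := fun i => sub_pos.2 (hxz i)
  obtain ⟨A, B, hAc, hBc, hA, hB, hA0, hB0, hA1, hB1, hAB⟩ := exists_monotone_pair
    (dense_preimage_affine dense_compl_cantorF (x 0) (hpos 0).ne')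
    (dense_preimage_affine dense_compl_cantorF (x 1) (hpos 1).ne')
    (by simpa using hz 0) (by simpa using hz 1)
  refine ⟨fun u => !₂[x 0 + (z 0 - x 0) * A u, x 1 + (z 1 - x 1) * B u],
    fun u => (z 0 - x 0) * A u + (z 1 - x 1) * B u, by fun_prop, ?_, fun u hu => ?_,
    fun u hu => ?_, fun s t hst => ?_, by simp [hA0, hB0], fun u hu => by
      simp [hA1 u hu, hB1 u hu]⟩
  · ext i; fin_cases i <;> simp [hA0, hB0]
  · ext i; fin_cases i <;> simp [hA1 u hu, hB1 u hu]
  · rintro ⟨h0, h1⟩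
    rcases hAB u hu with h | h
    · exact h (by simpa using h0)
    · exact h (by simpa using h1)
  · refine (dist_le_abs_add_abs _ _).trans (le_of_eq ?_)
    have h0 := mul_le_mul_of_nonneg_left (hA hst) (hpos 0).le
    have h1 := mul_le_mul_of_nonneg_left (hB hst) (hpos 1).le
    simp only [Matrix.cons_val_zero, Matrix.cons_val_one]
    rw [abs_of_nonpos (by linarith), abs_of_nonpos (by linarith)]
    ring

/-- there is `C_E > 1` such that any two points of `ℝ²` are joined by a
rectifiable curve of Euclidean length at most `C_E |x − y|` whose image meets `E` in at
most two points. -/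
theorem stmt9 :
    ∃ C_E : ℝ, 1 < C_E ∧
      ∀ x y : E2,
        ∃ γ : ℝ → E2, ContinuousOn γ (Set.Icc 0 1) ∧ γ 0 = x ∧ γ 1 = y ∧
          eVariationOn γ (Set.Icc 0 1) ≤ ENNReal.ofReal (C_E * dist x y) ∧
          ∃ a b : E2, (γ '' Set.Icc 0 1) ∩ cantorE ⊆ {a, b} := by
  refine ⟨8, by norm_num, fun x y => ?_⟩
  obtain rfl | hxy := eq_or_ne x y
  · refine ⟨fun _ => x, continuousOn_const, rfl, rfl, ?_, x, x, ?_⟩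
    · exact (eVariationOn_le_of_dist_le (G := fun _ => 0) (by simp) 0 1).trans (by simp)
    · rintro _ ⟨⟨_, _, rfl⟩, _⟩
      simp
  have hd : 0 < dist x y := dist_pos.2 hxy
  have hex : ∀ i, ∃ a ∉ cantorF, max (x i) (y i) < a ∧ a < max (x i) (y i) + dist x y := fun i =>
    dense_compl_cantorF.exists_between (lt_add_of_pos_right _ hd)
  choose a haF hlow hup using hex
  let z : E2 := WithLp.toLp 2 a
  obtain ⟨P, M, hPc, hP0, hP1, hPE, hPM, hM0, hM1⟩ :=
    exists_curve_avoiding (x := x) (z := z) (fun i => (le_max_left _ _).trans_lt (hlow i)) haF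
  obtain ⟨Q, N, hQc, hQ0, hQ1, hQE, hQN, hN0, hN1⟩ :=
    exists_curve_avoiding (x := y) (z := z) (fun i => (le_max_right _ _).trans_lt (hlow i)) haF
  let γ : ℝ → E2 := fun u => P (2 * u) + Q (2 - 2 * u) - z
  have hγP : ∀ u ≤ 1 / 2, γ u = P (2 * u) := fun u hu => by
    simp only [γ, hQ1 (2 - 2 * u) (by linarith), add_sub_cancel_right]
  have hγQ : ∀ u ≥ 1 / 2, γ u = Q (2 - 2 * u) := fun u hu => by
    simp only [γ, hP1 (2 * u) (by linarith), add_sub_cancel_left]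
  have hγ0 : γ 0 = x := by rw [hγP 0 (by norm_num), mul_zero, hP0]
  have hγ1 : γ 1 = y := by rw [hγQ 1 (by norm_num), mul_one, sub_self, hQ0]
  refine ⟨γ, Continuous.continuousOn (by fun_prop), hγ0, hγ1, ?_, x, y, ?_⟩
  · refine (eVariationOn_le_of_dist_le (G := fun u => M (2 * u) - N (2 - 2 * u))
      (fun s t hst => ?_) 0 1).trans (ENNReal.ofReal_le_ofReal ?_)
    · have h₁ := hPM (2 * s) (2 * t) (by linarith)
      have h₂ := hQN (2 - 2 * t) (2 - 2 * s) (by linarith)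
      rw [dist_comm] at h₂
      have h₃ := dist_add_add_le (P (2 * s)) (Q (2 - 2 * s)) (P (2 * t)) (Q (2 - 2 * t))
      simp only [γ, dist_sub_right]
      linarith
    · have hbound : ∀ i, (z i - x i) + (z i - y i) ≤ 4 * dist x y := fun i => by
        have h := abs_le.1 (abs_sub_apply_le_dist x y i)
        have hz : z i < max (x i) (y i) + dist x y := hup i
        rcases max_cases (x i) (y i) with ⟨hmax, _⟩ | ⟨hmax, _⟩ <;> rw [hmax] at hz <;> linarith
      simp only [mul_one, mul_zero, sub_zero, sub_self, hM0, hN0, hM1 2 (by norm_num),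
        hN1 2 (by norm_num)]
      linarith [hbound 0, hbound 1]
  · rintro _ ⟨⟨u, ⟨hu0, hu1⟩, rfl⟩, huE⟩
    obtain rfl | hu0 := hu0.eq_or_lt
    · exact Or.inl hγ0
    obtain rfl | hu1 := hu1.eq_or_lt
    · exact Or.inr hγ1
    exfalso
    rcases le_total u (1 / 2) with hu | hu
    · rw [hγP u hu] at huE
      exact hPE _ (by linarith) huE
    · rw [hγQ u hu] at huE
      exact hQE _ (by linarith) huE

end
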